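/- (Theorem 2) For every optimal conditional machine U there exists a constant c ∈ ℕ such that the following holds. For all strings a, b, let L = log C(a) + log C(b) + max(0, I(a:b)). Then for all integers α, β with c·L ≤ α ≤ C(a) − c·L and c·L ≤ β ≤ C(b) − c·L, there exists a string y such that |C(a|y) − α| ≤ c and |C(b|y) − β| ≤ c (differences in ℤ). -/

import Mathlib

/-- A string is a finite binary string. -/
abbrev Str : Type := List Bool

/-- A conditional machine: a partial computable function mapping a pair of
strings `(p, y)` to a string. -/
abbrev CondMachine : Type := {V : Str × Str →. Str // Partrec V}

/-- `condC V x y` is `C_V(x|y)`: the least length of a program `p` with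
`V (p, y) = x`, as an element of `ℕ∞` (it is `⊤` if no such `p` exists). -/
noncomputable def condC (V : CondMachine) (x y : Str) : ℕ∞ :=
  sInf {n : ℕ∞ | ∃ p : Str, x ∈ V.1 (p, y) ∧ (p.length : ℕ∞) = n}

/-- A conditional machine `U` is optimal if for every conditional machine `V`
there is a constant `d` with `C_U(x|y) ≤ C_V(x|y) + d` for all `x, y`. -/
def OptimalMachine (U : CondMachine) : Prop :=
  ∀ V : CondMachine, ∃ d : ℕ, ∀ x y : Str, condC U x y ≤ condC V x y + (d : ℕ∞)

/-- For an optimal machine all complexities are finite natural numbers. -/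
noncomputable def KC (U : CondMachine) (x y : Str) : ℕ := (condC U x y).toNat

/-- `log2 n = Nat.log 2 (n + 2)`, so `log2 n ≥ 1`. -/
def log2 (n : ℕ) : ℕ := Nat.log 2 (n + 2)

/-- The parity of the number of edges joining colors `1` and `2`, for a single edge `x y`. -/
def edgeParity (x y : Fin 3) : ZMod 2 :=
  if (x = 1 ∧ y = 2) ∨ (x = 2 ∧ y = 1) then 1 else 0

theorem edgeParity_square (x y z w : Fin 3)
    (h : ∃ c, c ≠ x ∧ c ≠ y ∧ c ≠ z ∧ c ≠ w) :
    edgeParity x y + edgeParity z w = edgeParity x z + edgeParity y w := by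
  revert x y z w
  unfold edgeParity
  decide

/-- A Sperner-type lemma: under the boundary conditions below, a coloring of the grid in three
colors has a unit square whose vertices show all of them. -/
theorem exists_square_all_labels (l : ℕ → ℕ → Fin 3) (m n : ℕ)
    (h_left : ∀ j, l 0 j = 0) (h_right : ∀ j, l m j ≠ 0)
    (h_bot : ∀ i, l i 0 ≠ 2) (h_top : ∀ i, l i n ≠ 1) :
    ∃ i j, ∀ c, c = l i j ∨ c = l i (j + 1) ∨ c = l (i + 1) j ∨ c = l (i + 1) (j + 1) := by
  by_contra! hno
  have step (i : ℕ) : ∑ j ∈ Finset.range n, edgeParity (l i j) (l i (j + 1)) =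
      ∑ j ∈ Finset.range n, edgeParity (l (i + 1) j) (l (i + 1) (j + 1)) := by
    have key (j : ℕ) := edgeParity_square _ _ _ _ (hno i j)
    have tel (N : ℕ) : ∑ j ∈ Finset.range N, edgeParity (l i j) (l i (j + 1)) +
        ∑ j ∈ Finset.range N, edgeParity (l (i + 1) j) (l (i + 1) (j + 1)) =
        edgeParity (l i 0) (l (i + 1) 0) + edgeParity (l i N) (l (i + 1) N) := by
      induction N with
      | zero => simp [CharTwo.add_self_eq_zero]
      | succ N ih =>
        rw [Finset.sum_range_succ, Finset.sum_range_succ, add_add_add_comm, ih, key N,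
          add_assoc, ← add_assoc (edgeParity (l i N) _), CharTwo.add_self_eq_zero, zero_add]
    have hb (x y : Fin 3) (hx : x ≠ 2) (hy : y ≠ 2) : edgeParity x y = 0 := by
      simp [edgeParity, hx, hy]
    have ht (x y : Fin 3) (hx : x ≠ 1) (hy : y ≠ 1) : edgeParity x y = 0 := by
      simp [edgeParity, hx, hy]
    have := tel n
    rw [hb _ _ (h_bot _) (h_bot _), ht _ _ (h_top _) (h_top _), add_zero] at this
    exact CharTwo.add_eq_zero.mp this
  have column (i : ℕ) : ∑ j ∈ Finset.range n, edgeParity (l i j) (l i (j + 1)) = 0 := by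
    induction i with
    | zero => simp [h_left, edgeParity]
    | succ i ih => rw [← step, ih]
  have tel (N : ℕ) : ∑ j ∈ Finset.range N, edgeParity (l m j) (l m (j + 1)) =
      if l m N = 1 then 0 else 1 := by
    induction N with
    | zero =>
      have : ∀ x : Fin 3, x ≠ 0 → x ≠ 2 → x = 1 := by decide
      simp [this _ (h_right 0) (h_bot m)]
    | succ N ih =>
      have : ∀ x y : Fin 3, x ≠ 0 → y ≠ 0 →
          (if x = 1 then (0 : ZMod 2) else 1) + edgeParity x y = if y = 1 then 0 else 1 := by
        unfold edgeParity; decide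
      rw [Finset.sum_range_succ, ih, this _ _ (h_right _) (h_right _)]
  simpa [h_top m] using (tel n).symm.trans (column m)

/-- The color of a pair of integers: `0` if the first is negative, `1` if only the second is,
and `2` if neither is. -/
def signLabel (x y : ℤ) : Fin 3 := if x < 0 then 0 else if y < 0 then 1 else 2

theorem neg_of_zero_eq_signLabel {x y : ℤ} (h : 0 = signLabel x y) : x < 0 := by
  unfold signLabel at h
  split_ifs at h <;> simp_all

theorem neg_of_one_eq_signLabel {x y : ℤ} (h : 1 = signLabel x y) : y < 0 := by
  unfold signLabel at h
  split_ifs at h <;> simp_all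

theorem nonneg_of_two_eq_signLabel {x y : ℤ} (h : 2 = signLabel x y) : 0 ≤ x ∧ 0 ≤ y := by
  unfold signLabel at h
  split_ifs at h <;> simp_all

/-- A discrete Poincaré–Miranda theorem: if `f` and `g` vary by at most `k` along each edge of a
grid and change sign between opposite sides of an `m × n` rectangle, then both are within `2 * k`
of zero at a common point. -/
theorem exists_near_zero (f g : ℕ → ℕ → ℤ) (m n : ℕ) (k : ℤ)
    (hf₁ : ∀ i j, |f (i + 1) j - f i j| ≤ k) (hf₂ : ∀ i j, |f i (j + 1) - f i j| ≤ k)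
    (hg₁ : ∀ i j, |g (i + 1) j - g i j| ≤ k) (hg₂ : ∀ i j, |g i (j + 1) - g i j| ≤ k)
    (hf_left : ∀ j, f 0 j < 0) (hf_right : ∀ j, 0 ≤ f m j)
    (hg_bot : ∀ i, g i 0 < 0) (hg_top : ∀ i, 0 ≤ g i n) :
    ∃ i j, |f i j| ≤ 2 * k ∧ |g i j| ≤ 2 * k := by
  obtain ⟨i, j, h⟩ := exists_square_all_labels
    (fun i j => signLabel (f i j) (g i j)) m n
    (fun j => by simp [signLabel, hf_left])
    (fun j h => (hf_right j).not_gt (neg_of_zero_eq_signLabel h.symm))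
    (fun i h => (nonneg_of_two_eq_signLabel h.symm).2.not_gt (hg_bot i))
    (fun i h => (hg_top i).not_gt (neg_of_one_eq_signLabel h.symm))
  refine ⟨i, j, ?_⟩
  have h0 := (h 0).imp neg_of_zero_eq_signLabel (Or.imp neg_of_zero_eq_signLabel
    (Or.imp neg_of_zero_eq_signLabel neg_of_zero_eq_signLabel))
  have h1 := (h 1).imp neg_of_one_eq_signLabel (Or.imp neg_of_one_eq_signLabel
    (Or.imp neg_of_one_eq_signLabel neg_of_one_eq_signLabel))
  have h2 := (h 2).imp nonneg_of_two_eq_signLabel (Or.imp nonneg_of_two_eq_signLabel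
    (Or.imp nonneg_of_two_eq_signLabel nonneg_of_two_eq_signLabel))
  clear h
  have a1 := abs_le.mp (hf₁ i j)
  have a2 := abs_le.mp (hf₂ i j)
  have a3 := abs_le.mp (hf₂ (i + 1) j)
  have b1 := abs_le.mp (hg₁ i j)
  have b2 := abs_le.mp (hg₂ i j)
  have b3 := abs_le.mp (hg₂ (i + 1) j)
  simp only [abs_le]
  omega

theorem KC_le_of_machine {U : CondMachine} (hU : OptimalMachine U) (V : Str × Str →. Str)
    (hV : Partrec V) : ∃ d : ℕ, ∀ p x y, x ∈ V (p, y) → KC U x y ≤ p.length + d := by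
  obtain ⟨d, hd⟩ := hU ⟨V, hV⟩
  refine ⟨d, fun p x y h => ENat.toNat_le_of_le_natCast ((hd x y).trans ?_)⟩
  push_cast
  gcongr
  exact sInf_le ⟨p, h, rfl⟩

theorem exists_program {U : CondMachine} (hU : OptimalMachine U) (x y : Str) :
    ∃ p : Str, x ∈ U.1 (p, y) ∧ p.length = KC U x y := by
  obtain ⟨d, hd⟩ := hU ⟨fun z => Part.some z.1, Computable.fst.partrec⟩
  have hlt : condC U x y < ⊤ := by
    refine (hd x y).trans_lt ?_
    have : condC ⟨fun z => Part.some z.1, Computable.fst.partrec⟩ x y ≤ x.length :=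
      sInf_le ⟨x, Part.mem_some _, rfl⟩
    exact (add_le_add_left this _).trans_lt (by exact_mod_cast ENat.natCast_lt_top (x.length + d))
  have hne : {n : ℕ∞ | ∃ p : Str, x ∈ U.1 (p, y) ∧ (p.length : ℕ∞) = n}.Nonempty := by
    by_contra hemp
    rw [Set.not_nonempty_iff_eq_empty] at hemp
    simp [condC, hemp] at hlt
  obtain ⟨p, hp, hlen⟩ := csInf_mem hne
  refine ⟨p, hp, ?_⟩
  change _ = condC U x y at hlen
  simp [KC, ← hlen]

/-- Applying a computable function to the condition cannot help by more than a constant. -/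
theorem KC_le_of_condition {U : CondMachine} (hU : OptimalMachine U) {F : Str → Str}
    (hF : Computable F) : ∃ d : ℕ, ∀ x y, KC U x y ≤ KC U x (F y) + d := by
  obtain ⟨d, hd⟩ := KC_le_of_machine hU (fun z => U.1 (z.1, F z.2))
    (U.2.comp (Computable.pair .fst (hF.comp .snd)))
  refine ⟨d, fun x y => ?_⟩
  obtain ⟨p, hp, hlen⟩ := exists_program hU x (F y)
  exact hlen ▸ hd p x y hp

/-- An injective code for pairs of strings, used as a condition: its length is immaterial, so it
is written in unary. -/
def encPair (z : Str × Str) : Str := List.replicate (Encodable.encode z) true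

/-- A computable left inverse of `encPair`. -/
def decPair (y : Str) : Str × Str :=
  (Encodable.decode y.length : Option (Str × Str)).getD ([], [])

@[simp] theorem decPair_encPair (z : Str × Str) : decPair (encPair z) = z := by
  simp [decPair, encPair]

theorem computable_encPair : Computable encPair := by
  have : Primrec encPair := by
    refine ((Primrec.list_map (Primrec.list_range.comp Primrec.encode)
      (Primrec.const true).to₂ :
      Primrec fun z : Str × Str => (List.range (Encodable.encode z)).map fun _ => true)).of_eq ?_
    simp [encPair]
  exact this.to_comp

theorem computable_decPair : Computable decPair :=
  Computable.option_getD (Computable.decode.comp Computable.list_length) (Computable.const _)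

theorem KC_encPair_le {U : CondMachine} (hU : OptimalMachine U) {F : Str × Str → Str × Str}
    (hF : Computable F) :
    ∃ d : ℕ, ∀ x z, KC U x (encPair z) ≤ KC U x (encPair (F z)) + d := by
  obtain ⟨d, hd⟩ := KC_le_of_condition hU
    (computable_encPair.comp (hF.comp computable_decPair))
  exact ⟨d, fun x z => by simpa using hd x (encPair z)⟩

/-- Removing one bit from a component of the condition changes complexities by `O(1)`. -/
theorem KC_encPair_drop_succ {U : CondMachine} (hU : OptimalMachine U) :
    ∃ d : ℕ, ∀ (x u v : Str) (i : ℕ),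
      |(KC U x (encPair (u.drop (i + 1), v)) : ℤ) - KC U x (encPair (u.drop i, v))| ≤ d ∧
      |(KC U x (encPair (v, u.drop (i + 1))) : ℤ) - KC U x (encPair (v, u.drop i))| ≤ d := by
  have tl : Computable (List.tail : Str → Str) := Primrec.list_tail.to_comp
  have cns (b : Bool) : Computable (List.cons b : Str → Str) :=
    Computable.list_cons.comp (.const b) .id
  have left {f : Str → Str} (hf : Computable f) :
      Computable fun z : Str × Str => (f z.1, z.2) := .pair (hf.comp .fst) .snd
  have right {f : Str → Str} (hf : Computable f) :
      Computable fun z : Str × Str => (z.1, f z.2) := .pair .fst (hf.comp .snd)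
  obtain ⟨d₁, h₁⟩ := KC_encPair_le hU (left tl)
  obtain ⟨d₂, h₂⟩ := KC_encPair_le hU (left (cns true))
  obtain ⟨d₃, h₃⟩ := KC_encPair_le hU (left (cns false))
  obtain ⟨e₁, k₁⟩ := KC_encPair_le hU (right tl)
  obtain ⟨e₂, k₂⟩ := KC_encPair_le hU (right (cns true))
  obtain ⟨e₃, k₃⟩ := KC_encPair_le hU (right (cns false))
  refine ⟨d₁ + d₂ + d₃ + e₁ + e₂ + e₃, fun x u v i => ?_⟩
  rcases lt_or_ge i u.length with hi | hi
  · have h1 := h₁ x (u.drop i, v)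
    have h2 := h₂ x (u.drop (i + 1), v)
    have h3 := h₃ x (u.drop (i + 1), v)
    have k1 := k₁ x (v, u.drop i)
    have k2 := k₂ x (v, u.drop (i + 1))
    have k3 := k₃ x (v, u.drop (i + 1))
    simp only [List.tail_drop] at h1 k1
    rw [List.drop_eq_getElem_cons hi] at h1 k1 ⊢
    simp only [abs_le]
    cases hu : u[i] <;> rw [hu] at h1 k1 <;> dsimp only at h2 h3 k2 k3 <;> omega
  · rw [List.drop_of_length_le hi, List.drop_of_length_le (hi.trans (Nat.le_succ i))]
    simp only [sub_self, abs_zero]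
    omega

theorem KC_encPair_program_le {U : CondMachine} (hU : OptimalMachine U) :
    ∃ d : ℕ, ∀ x p v : Str, x ∈ U.1 (p, []) →
      KC U x (encPair (p, v)) ≤ d ∧ KC U x (encPair (v, p)) ≤ d := by
  obtain ⟨d₁, h₁⟩ := KC_le_of_machine hU (fun z => U.1 ((decPair z.2).1, []))
    (U.2.comp (.pair (Computable.fst.comp (computable_decPair.comp .snd)) (.const [])))
  obtain ⟨d₂, h₂⟩ := KC_le_of_machine hU (fun z => U.1 ((decPair z.2).2, []))
    (U.2.comp (.pair (Computable.snd.comp (computable_decPair.comp .snd)) (.const [])))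
  refine ⟨max d₁ d₂, fun x p v hx => ?_⟩
  have h1 := h₁ [] x (encPair (p, v)) (by simpa using hx)
  have h2 := h₂ [] x (encPair (v, p)) (by simpa using hx)
  simp only [List.length_nil] at h1 h2
  omega

/-- The string `r` preceded by a self-delimiting code of `n`. -/
def natHeader (n : ℕ) (r : Str) : Str :=
  List.replicate n.bits.length true ++ false :: (n.bits ++ r)

/-- The natural number with the given binary digits, least significant first. -/
def natOfBits (w : Str) : ℕ := w.foldr Nat.bit 0

theorem natOfBits_bits (n : ℕ) : natOfBits n.bits = n := by
  induction n using Nat.binaryRec' with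
  | zero => simp [natOfBits]
  | bit b n h ih => rw [Nat.bits_append_bit n b h]; simpa [natOfBits] using congrArg (Nat.bit b) ih

theorem computable_natOfBits : Computable natOfBits := by
  have hbit : Primrec₂ Nat.bit :=
    (Primrec.cond Primrec.fst (Primrec.nat_double_succ.comp Primrec.snd)
      (Primrec.nat_double.comp Primrec.snd)).of_eq fun z => by cases z.1 <;> rfl
  exact (Primrec.list_foldr Primrec.id (Primrec.const 0)
    (hbit.comp (Primrec.fst.comp Primrec.snd) (Primrec.snd.comp Primrec.snd)).to₂).to_comp

/-- A left inverse of `natHeader`. -/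
def parseNat (p : Str) : ℕ × Str :=
  (natOfBits ((p.drop (p.idxOf false + 1)).take (p.idxOf false)),
    (p.drop (p.idxOf false + 1)).drop (p.idxOf false))

theorem parseNat_natHeader (n : ℕ) (r : Str) : parseNat (natHeader n r) = (n, r) := by
  have hidx : (natHeader n r).idxOf false = n.bits.length := by
    simp [natHeader, List.idxOf_append]
  have hdrop : (natHeader n r).drop (n.bits.length + 1) = n.bits ++ r := by
    simp [natHeader, List.drop_append]
  simp [parseNat, hidx, hdrop, natOfBits_bits]

theorem computable_parseNat : Computable parseNat := by
  have idx : Primrec fun p : Str => p.idxOf false :=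
    Primrec.list_idxOf.comp (Primrec.const false) Primrec.id
  have drp : Primrec fun p : Str => p.drop (p.idxOf false + 1) :=
    Primrec.list_drop.comp (Primrec.succ.comp idx) Primrec.id
  exact .pair (computable_natOfBits.comp (Primrec.list_take.comp idx drp).to_comp)
    (Primrec.list_drop.comp idx drp).to_comp

theorem length_bits_pair_le {i m : ℕ} (h : i ≤ m) :
    (Nat.pair i m).bits.length ≤ 2 * log2 m + 2 := by
  rw [Nat.size_eq_bits_len, Nat.size_le]
  have h1 := Nat.pair_lt_max_add_one_sq i m
  have h2 : m + 2 < 2 ^ (log2 m + 1) := Nat.lt_pow_succ_log_self one_lt_two _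
  rw [max_eq_right h] at h1
  calc Nat.pair i m < (m + 1) ^ 2 := h1
    _ ≤ (2 ^ (log2 m + 1)) ^ 2 := by gcongr; omega
    _ = 2 ^ (2 * log2 m + 2) := by rw [← pow_mul]; ring_nf

/-- If `p` is a program for `b`, then `a` and `b` can be obtained from `p` and a program for `a` that
uses a suffix of `p`, at a logarithmic cost. -/
theorem KC_joint_le {U : CondMachine} (hU : OptimalMachine U) {G : Str → Str}
    (hG : Computable G) {H : Str × Str → Str} (hH : Computable H) :
    ∃ d : ℕ, ∀ (a b p : Str) (i : ℕ), b ∈ U.1 (p, []) →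
      KC U (H (a, b)) [] ≤ KC U a (G (p.drop i)) + p.length + 4 * log2 p.length + d := by
  -- a program is parsed into an index, a length, the program for `b`, and the program for `a`
  let idx : Str → ℕ := fun r => (parseNat r).1.unpair.1
  let len : Str → ℕ := fun r => (parseNat r).1.unpair.2
  have c_idx : Computable idx :=
    Computable.fst.comp (Computable.unpair.comp (Computable.fst.comp computable_parseNat))
  have c_len : Computable len :=
    Computable.snd.comp (Computable.unpair.comp (Computable.fst.comp computable_parseNat))
  have c_rest : Computable fun r => (parseNat r).2 := Computable.snd.comp computable_parseNat
  have c_p : Computable fun r => (parseNat r).2.take (len r) :=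
    Primrec.list_take.to_comp.comp c_len c_rest
  have c_q : Computable fun r => (parseNat r).2.drop (len r) :=
    Primrec.list_drop.to_comp.comp c_len c_rest
  have c_cond : Computable fun r => G (((parseNat r).2.take (len r)).drop (idx r)) :=
    hG.comp (Primrec.list_drop.to_comp.comp c_idx c_p)
  have hA : Partrec fun z : Str × Str => U.1 ((parseNat z.1).2.drop (len z.1),
      G (((parseNat z.1).2.take (len z.1)).drop (idx z.1))) :=
    U.2.comp (.pair (c_q.comp .fst) (c_cond.comp .fst))
  have hB : Partrec fun z : Str × Str => U.1 ((parseNat z.1).2.take (len z.1), []) :=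
    U.2.comp (.pair (c_p.comp .fst) (.const []))
  obtain ⟨d, hd⟩ := KC_le_of_machine hU _ (hA.bind
    ((hB.comp Computable.fst).map (hH.comp (.pair (Computable.snd.comp .fst) .snd)).to₂).to₂)
  refine ⟨d + 5, fun a b p i' hb => ?_⟩
  obtain ⟨i, hi, hdrop⟩ : ∃ i ≤ p.length, p.drop i' = p.drop i := by
    rcases le_total i' p.length with h | h
    · exact ⟨i', h, rfl⟩
    · exact ⟨p.length, le_rfl, by simp [h]⟩
  rw [hdrop]
  obtain ⟨q, hq, hlen⟩ := exists_program hU a (G (p.drop i))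
  have h := hd (natHeader (Nat.pair i p.length) (p ++ q)) (H (a, b)) [] (by
    simp only [Part.mem_bind_iff, Part.mem_map_iff]
    refine ⟨a, ?_, b, ?_, rfl⟩ <;> simpa [idx, len, parseNat_natHeader])
  have hbits := length_bits_pair_le hi
  have hl : (natHeader (Nat.pair i p.length) (p ++ q)).length =
      2 * (Nat.pair i p.length).bits.length + 1 + p.length + q.length := by
    simp [natHeader]; ring
  omega

/-- Theorem 2: given a computable injective pairing, for all strings `a, b` and
all integers `α, β` that are at least `c·L` away from the endpoints of
`[0, C(a)]` and `[0, C(b)]` respectively, where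
`L = log C(a) + log C(b) + max(0, I(a:b))`, there exists a string `y` with
`C(a|y) = α + O(1)` and `C(b|y) = β + O(1)`. -/
theorem decrease_complexity_by_oracle (U : CondMachine) (hU : OptimalMachine U)
    (pair : Str → Str → Str)
    (hpair_comp : Computable fun p : Str × Str => pair p.1 p.2)
    (hpair_inj : Function.Injective fun p : Str × Str => pair p.1 p.2) :
    ∃ c : ℕ, ∀ a b : Str,
      ∀ α β : ℤ,
        (c : ℤ) * ((log2 (KC U a []) : ℤ) + (log2 (KC U b []) : ℤ) +
            max 0 ((KC U a [] : ℤ) + (KC U b [] : ℤ) - (KC U (pair a b) [] : ℤ))) ≤ α →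
        α ≤ (KC U a [] : ℤ) - (c : ℤ) * ((log2 (KC U a []) : ℤ) + (log2 (KC U b []) : ℤ) +
            max 0 ((KC U a [] : ℤ) + (KC U b [] : ℤ) - (KC U (pair a b) [] : ℤ))) →
        (c : ℤ) * ((log2 (KC U a []) : ℤ) + (log2 (KC U b []) : ℤ) +
            max 0 ((KC U a [] : ℤ) + (KC U b [] : ℤ) - (KC U (pair a b) [] : ℤ))) ≤ β →
        β ≤ (KC U b [] : ℤ) - (c : ℤ) * ((log2 (KC U a []) : ℤ) + (log2 (KC U b []) : ℤ) +
            max 0 ((KC U a [] : ℤ) + (KC U b [] : ℤ) - (KC U (pair a b) [] : ℤ))) →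
        ∃ y : Str, |(KC U a y : ℤ) - α| ≤ (c : ℤ) ∧ |(KC U b y : ℤ) - β| ≤ (c : ℤ) := by
  obtain ⟨k, hk⟩ := KC_encPair_drop_succ hU
  obtain ⟨e, he⟩ := KC_encPair_program_le hU
  obtain ⟨d₁, hd₁⟩ := KC_joint_le hU (computable_encPair.comp (.pair (.const []) .id)) hpair_comp
  obtain ⟨d₂, hd₂⟩ := KC_joint_le hU (computable_encPair.comp (.pair .id (.const [])))
    (H := fun z => pair z.2 z.1) (hpair_comp.comp (.pair .snd .fst))
  refine ⟨2 * k + e + d₁ + d₂ + 4, fun a b α β hα₁ hα₂ hβ₁ hβ₂ => ?_⟩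
  obtain ⟨p, hp, hp_len⟩ := exists_program hU a []
  obtain ⟨q, hq, hq_len⟩ := exists_program hU b []
  rw [← hp_len, ← hq_len] at hα₁ hα₂ hβ₁ hβ₂
  have log2_pos (n : ℕ) : 1 ≤ log2 n := Nat.log_pos one_lt_two (by omega)
  set I : ℤ := (p.length : ℤ) + q.length - KC U (pair a b) [] with hI
  set L : ℤ := (log2 p.length : ℤ) + log2 q.length + max 0 I with hL
  have hp_log := log2_pos p.length
  have hq_log := log2_pos q.length
  have hI_le : I ≤ max 0 I := le_max_right 0 I
  have hI_nonneg : 0 ≤ max 0 I := le_max_left 0 I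
  have hcL : (2 * k + e + d₁ + d₂ : ℤ) * 1 + 4 * L ≤
      ((2 * k + e + d₁ + d₂ + 4 : ℕ) : ℤ) * L := by
    push_cast
    rw [add_mul _ 4 L]
    gcongr
    omega
  obtain ⟨i, j, hi, hj⟩ := exists_near_zero
    (fun i j => (KC U a (encPair (p.drop i, q.drop j)) : ℤ) - α)
    (fun i j => (KC U b (encPair (p.drop i, q.drop j)) : ℤ) - β) p.length q.length k
    (fun i j => by simpa using (hk a p (q.drop j) i).1)
    (fun i j => by simpa using (hk a q (p.drop i) j).2)
    (fun i j => by simpa using (hk b p (q.drop j) i).1)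
    (fun i j => by simpa using (hk b q (p.drop i) j).2)
    (fun j => by
      have := (he a p (q.drop j) hp).1
      simp only [List.drop_zero]
      omega)
    (fun j => by
      have := hd₁ a b q j hq
      simp only [id] at this
      simp only [List.drop_length]
      omega)
    (fun i => by
      have := (he b q (p.drop i) hq).2
      simp only [List.drop_zero]
      omega)
    (fun i => by
      have := hd₂ b a p i hp
      simp only [id] at this
      simp only [List.drop_length]
      omega)
  exact ⟨_, hi.trans (by push_cast; omega), hj.trans (by push_cast; omega)⟩
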